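/- arXiv:2406.03945 — 7 statements merged into one kernel-verified Lean document; each statement's English description precedes it below -/
import Mathlib

section
/- Let ρ be a two-qubit state and let f_B be an invertible 2×2 complex matrix. Then the set of Alice's steered states of ρ, namely { tr_B[(𝟙⊗E)ρ] / tr[(𝟙⊗E)ρ] : E a 2×2 matrix with 0 ≤ E ≤ 𝟙 and tr[(𝟙⊗E)ρ] > 0 }, is equal to the corresponding set of Alice's steered states of the Bob-filtered state ρ'_FB = (𝟙⊗f_B)ρ(𝟙⊗f_B)† / tr[(𝟙⊗f_B†f_B)ρ]. -/
open Matrix Kronecker Complex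
open scoped ComplexOrder

noncomputable section

/-- 2×2 complex matrices (one qubit operators). -/
abbrev Mat2 := Matrix (Fin 2) (Fin 2) ℂ
/-- 4×4 complex matrices, indexed by ℂ²⊗ℂ² product indices (two qubit operators). -/
abbrev Mat4 := Matrix (Fin 2 × Fin 2) (Fin 2 × Fin 2) ℂ

/-- A two-qubit state: positive semidefinite with trace 1. -/
def IsState (ρ : Mat4) : Prop := ρ.PosSemidef ∧ ρ.trace = 1

/-- The Pauli matrices σ₁, σ₂, σ₃ (indexed by 0,1,2). -/
def pauli : Fin 3 → Mat2 :=
  ![!![0, 1; 1, 0], !![0, -Complex.I; Complex.I, 0], !![1, 0; 0, -1]]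

/-- Alice's Bloch vector: a_i = tr((σ_i ⊗ 𝟙)ρ). -/
def aVec (ρ : Mat4) : Fin 3 → ℝ := fun i => ((pauli i ⊗ₖ (1 : Mat2)) * ρ).trace.re
/-- Bob's Bloch vector: b_i = tr((𝟙 ⊗ σ_i)ρ). -/
def bVec (ρ : Mat4) : Fin 3 → ℝ := fun i => (((1 : Mat2) ⊗ₖ pauli i) * ρ).trace.re
/-- Correlation matrix: T_{ij} = tr((σ_i ⊗ σ_j)ρ). -/
def Tmat (ρ : Mat4) : Matrix (Fin 3) (Fin 3) ℝ :=
  Matrix.of fun i j => ((pauli i ⊗ₖ pauli j) * ρ).trace.re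

/-- Euclidean norm on ℝ³. -/
def norm3 (v : Fin 3 → ℝ) : ℝ := Real.sqrt (∑ i, v i ^ 2)

/-- Alice's quantum steering ellipsoid centre c_A = γ_b²(a − T b), γ_b² = 1/(1 − ‖b‖²). -/
def cA (ρ : Mat4) : Fin 3 → ℝ :=
  (1 - norm3 (bVec ρ) ^ 2)⁻¹ • (aVec ρ - Tmat ρ *ᵥ bVec ρ)
/-- Bob's quantum steering ellipsoid centre c_B = γ_a²(b − Tᵀ a), γ_a² = 1/(1 − ‖a‖²). -/
def cB (ρ : Mat4) : Fin 3 → ℝ :=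
  (1 - norm3 (aVec ρ) ^ 2)⁻¹ • (bVec ρ - (Tmat ρ)ᵀ *ᵥ aVec ρ)

/-- Alice's QSE matrix Q_A = γ_b²(T − a bᵀ)(𝟙₃ + γ_b² b bᵀ)(Tᵀ − b aᵀ). -/
def QA (ρ : Mat4) : Matrix (Fin 3) (Fin 3) ℝ :=
  (1 - norm3 (bVec ρ) ^ 2)⁻¹ •
    ((Tmat ρ - vecMulVec (aVec ρ) (bVec ρ)) *
      (1 + (1 - norm3 (bVec ρ) ^ 2)⁻¹ • vecMulVec (bVec ρ) (bVec ρ)) *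
      ((Tmat ρ)ᵀ - vecMulVec (bVec ρ) (aVec ρ)))

/-- Bob's QSE matrix Q_B = γ_a²(Tᵀ − b aᵀ)(𝟙₃ + γ_a² a aᵀ)(T − a bᵀ). -/
def QB (ρ : Mat4) : Matrix (Fin 3) (Fin 3) ℝ :=
  (1 - norm3 (aVec ρ) ^ 2)⁻¹ •
    (((Tmat ρ)ᵀ - vecMulVec (bVec ρ) (aVec ρ)) *
      (1 + (1 - norm3 (aVec ρ) ^ 2)⁻¹ • vecMulVec (aVec ρ) (aVec ρ)) *
      (Tmat ρ - vecMulVec (aVec ρ) (bVec ρ)))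

/-- The Alice-filtered state ρ'_FA = (f⊗𝟙)ρ(f⊗𝟙)† / tr[(f†f⊗𝟙)ρ]. -/
def filterA (ρ : Mat4) (f : Mat2) : Mat4 :=
  ((((fᴴ * f) ⊗ₖ (1 : Mat2)) * ρ).trace)⁻¹ • ((f ⊗ₖ (1 : Mat2)) * ρ * (f ⊗ₖ (1 : Mat2))ᴴ)

/-- The Bob-filtered state ρ'_FB = (𝟙⊗f)ρ(𝟙⊗f)† / tr[(𝟙⊗f†f)ρ]. -/
def filterB (ρ : Mat4) (f : Mat2) : Mat4 :=
  ((((1 : Mat2) ⊗ₖ (fᴴ * f)) * ρ).trace)⁻¹ • (((1 : Mat2) ⊗ₖ f) * ρ * ((1 : Mat2) ⊗ₖ f)ᴴ)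

/-- The two-sided filtered state (f_A⊗f_B)ρ(f_A⊗f_B)† / tr[(f_A†f_A ⊗ f_B†f_B)ρ]. -/
def filterAB (ρ : Mat4) (f g : Mat2) : Mat4 :=
  ((((fᴴ * f) ⊗ₖ (gᴴ * g)) * ρ).trace)⁻¹ • ((f ⊗ₖ g) * ρ * (f ⊗ₖ g)ᴴ)

/-- The qubit observable α·σ for α ∈ ℝ³. -/
def obs (α : Fin 3 → ℝ) : Mat2 := ∑ k, (α k : ℂ) • pauli k

/-- The expectation value ⟨A⊗B⟩_ρ = tr((A⊗B)ρ) (real for states/Hermitian observables). -/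
def expVal (ρ : Mat4) (A B : Mat2) : ℝ := ((A ⊗ₖ B) * ρ).trace.re

/-- The CHSH functional ½(⟨A¹B¹⟩+⟨A¹B²⟩+⟨A²B¹⟩−⟨A²B²⟩). -/
def chshVal (ρ : Mat4) (α1 α2 β1 β2 : Fin 3 → ℝ) : ℝ :=
  (expVal ρ (obs α1) (obs β1) + expVal ρ (obs α1) (obs β2)
    + expVal ρ (obs α2) (obs β1) - expVal ρ (obs α2) (obs β2)) / 2

/-- The maximal CHSH value B(ρ) over measurement directions (unit vectors in ℝ³). -/
def Bval (ρ : Mat4) : ℝ :=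
  sSup {x | ∃ α1 α2 β1 β2 : Fin 3 → ℝ, norm3 α1 = 1 ∧ norm3 α2 = 1 ∧
    norm3 β1 = 1 ∧ norm3 β2 = 1 ∧ x = chshVal ρ α1 α2 β1 β2}

/-- The F₃ functional (1/√3)Σᵢ tr((Aⁱ⊗σᵢ)ρ). -/
def f3Val (ρ : Mat4) (α : Fin 3 → Fin 3 → ℝ) : ℝ :=
  (∑ i, expVal ρ (obs (α i)) (pauli i)) / Real.sqrt 3

/-- The maximal F₃ value over measurement directions. -/
def F3val (ρ : Mat4) : ℝ :=
  sSup {x | ∃ α : Fin 3 → Fin 3 → ℝ, (∀ i, norm3 (α i) = 1) ∧ x = f3Val ρ α}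

/-- Partial trace over Bob (second factor). -/
def trB (M : Mat4) : Mat2 := Matrix.of fun i j => ∑ k, M (i, k) (j, k)
/-- Partial trace over Alice (first factor). -/
def trA (M : Mat4) : Mat2 := Matrix.of fun i j => ∑ k, M (k, i) (k, j)

/-- The vector |φ⁺(θ)⟩ = cosθ|00⟩ + sinθ|11⟩. -/
def phiVec (θ : ℝ) : Fin 2 × Fin 2 → ℂ :=
  fun q => if q = (0, 0) then (Real.cos θ : ℂ) else if q = (1, 1) then (Real.sin θ : ℂ) else 0

/-- The projector φ⁺(θ) = |φ⁺(θ)⟩⟨φ⁺(θ)|. -/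
def phiProj (θ : ℝ) : Mat4 := vecMulVec (phiVec θ) (star (phiVec θ))

/-- ρ_A(θ) = tr_B φ⁺(θ) = diag(cos²θ, sin²θ). -/
def rhoA (θ : ℝ) : Mat2 := !![(Real.cos θ : ℂ) ^ 2, 0; 0, (Real.sin θ : ℂ) ^ 2]

/-- Partially entangled state with one-sided coloured noise. -/
def rhoM (θ p : ℝ) : Mat4 :=
  (p : ℂ) • phiProj θ + ((1 - p : ℝ) : ℂ) • (rhoA θ ⊗ₖ ((1 / 2 : ℂ) • (1 : Mat2)))

/-- Partially entangled state with symmetric coloured noise. -/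
def rhoMM (θ p : ℝ) : Mat4 :=
  (p : ℂ) • phiProj θ + ((1 - p : ℝ) : ℂ) • (rhoA θ ⊗ₖ rhoA θ)

/-- The vector |Φ⁺⟩ = (|00⟩+|11⟩)/√2. -/
def maxEntVec : Fin 2 × Fin 2 → ℂ :=
  fun q => if q.1 = q.2 then ((Real.sqrt 2 : ℂ))⁻¹ else 0

/-- The projector Φ⁺ = |Φ⁺⟩⟨Φ⁺|. -/
def maxEntProj : Mat4 := vecMulVec maxEntVec (star maxEntVec)

/-- The singlet vector |Ψ⁻⟩ = (|01⟩−|10⟩)/√2. -/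
def singletVec : Fin 2 × Fin 2 → ℂ :=
  fun q => if q = (0, 1) then ((Real.sqrt 2 : ℂ))⁻¹
    else if q = (1, 0) then -((Real.sqrt 2 : ℂ))⁻¹ else 0

/-- The singlet projector |Ψ⁻⟩⟨Ψ⁻|. -/
def singletProj : Mat4 := vecMulVec singletVec (star singletVec)

/-- The vector |00⟩. -/
def zeroVec : Fin 2 × Fin 2 → ℂ := fun q => if q = (0, 0) then 1 else 0

/-- The quasi-distillable state ρ_QD(p) = p|Ψ⁻⟩⟨Ψ⁻| + (1−p)|00⟩⟨00|. -/
def rhoQD (p : ℝ) : Mat4 :=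
  (p : ℂ) • singletProj + ((1 - p : ℝ) : ℂ) • vecMulVec zeroVec (star zeroVec)

/-- The partial trace over Bob is cyclic with respect to operators acting on Bob's side. -/
lemma trB_one_kronecker_mul_comm (X : Mat2) (M : Mat4) :
    trB (((1 : Mat2) ⊗ₖ X) * M) = trB (M * ((1 : Mat2) ⊗ₖ X)) := by
  ext i j
  fin_cases i <;> fin_cases j <;>
    simp [trB, Matrix.mul_apply, Fintype.sum_prod_type, Fin.sum_univ_two] <;> ring

lemma trace_trB (M : Mat4) : (trB M).trace = M.trace := by
  simp [trB, Matrix.trace, Fintype.sum_prod_type]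

lemma trB_smul (c : ℂ) (M : Mat4) : trB (c • M) = c • trB M := by
  ext i j
  simp [trB, mul_add]

/-- Bob's filter can be moved from the state onto the effect. -/
lemma trB_one_kronecker_mul_conj (E f : Mat2) (ρ : Mat4) :
    trB (((1 : Mat2) ⊗ₖ E) * (((1 : Mat2) ⊗ₖ f) * ρ * ((1 : Mat2) ⊗ₖ f)ᴴ)) =
      trB (((1 : Mat2) ⊗ₖ (fᴴ * E * f)) * ρ) := by
  rw [conjTranspose_kronecker, conjTranspose_one, ← Matrix.mul_assoc,
    ← trB_one_kronecker_mul_comm]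
  simp only [← Matrix.mul_assoc, ← Matrix.mul_kronecker_mul, Matrix.one_mul]

/-- Every positive semidefinite qubit operator is a positive multiple of an effect. -/
lemma exists_pos_smul_le_one {E : Mat2} (hE : E.PosSemidef) :
    ∃ c : ℝ, 0 < c ∧ ((1 : Mat2) - (c : ℂ) • E).PosSemidef := by
  obtain ⟨s, hs, hsE⟩ : ∃ s : ℝ, 0 ≤ s ∧ E.trace = (s : ℂ) := by
    obtain ⟨h₁, h₂⟩ := Complex.le_def.1 hE.trace_nonneg
    exact ⟨E.trace.re, h₁, Complex.ext rfl h₂.symm⟩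
  have hs' : (0 : ℝ) < 1 + s := by linarith
  refine ⟨(1 + s)⁻¹, inv_pos.2 hs', ?_⟩
  have hadj := hE.transpose.mul_mul_conjTranspose_same (!![0, 1; -1, 0] : Mat2)
  have heq : (1 : Mat2) + !![0, 1; -1, 0] * Eᵀ * (!![0, 1; -1, 0] : Mat2)ᴴ =
      ((1 + s : ℝ) : ℂ) • (1 : Mat2) - E := by
    push_cast
    rw [← hsE]
    ext i j
    fin_cases i <;> fin_cases j <;>
      simp [Matrix.mul_apply, vecMul, dotProduct, Matrix.trace, Fin.sum_univ_two] <;> ring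
  have hpos := (Matrix.PosSemidef.one.add hadj).smul
    (show (0 : ℂ) ≤ (((1 + s)⁻¹ : ℝ) : ℂ) by exact_mod_cast (inv_pos.2 hs').le)
  rw [heq, smul_sub, smul_smul, ← Complex.ofReal_mul, inv_mul_cancel₀ hs'.ne',
    Complex.ofReal_one, one_smul] at hpos
  exact hpos

/-- The normalized steered operators obtained from arbitrary positive semidefinite operators. -/
def coneSteered (ρ : Mat4) : Set Mat2 :=
  {τ | ∃ E : Mat2, E.PosSemidef ∧ ∃ t : ℝ, 0 < t ∧
    (((1 : Mat2) ⊗ₖ E) * ρ).trace = (t : ℂ) ∧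
      τ = ((t : ℂ))⁻¹ • trB (((1 : Mat2) ⊗ₖ E) * ρ)}

/-- By homogeneity, restricting to effects does not change the steered states. -/
lemma steered_eq_coneSteered (ρ : Mat4) :
    {τ : Mat2 | ∃ E : Mat2, E.PosSemidef ∧ ((1 : Mat2) - E).PosSemidef ∧
      ∃ t : ℝ, 0 < t ∧ (((1 : Mat2) ⊗ₖ E) * ρ).trace = (t : ℂ) ∧
        τ = ((t : ℂ))⁻¹ • trB (((1 : Mat2) ⊗ₖ E) * ρ)} = coneSteered ρ := by
  ext τ
  constructor
  · rintro ⟨E, hE, -, h⟩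
    exact ⟨E, hE, h⟩
  · rintro ⟨E, hE, t, ht, htr, rfl⟩
    obtain ⟨c, hc, hcE⟩ := exists_pos_smul_le_one hE
    have hc' : (c : ℂ) ≠ 0 := by exact_mod_cast hc.ne'
    refine ⟨(c : ℂ) • E, hE.smul (by exact_mod_cast hc.le), hcE, c * t, mul_pos hc ht, ?_, ?_⟩
    · rw [kronecker_smul, Matrix.smul_mul, trace_smul, htr, smul_eq_mul, Complex.ofReal_mul]
    · rw [kronecker_smul, Matrix.smul_mul, trB_smul, smul_smul, Complex.ofReal_mul,
        _root_.mul_inv_rev, inv_mul_cancel_right₀ hc']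

/-- Rescaling the operator and filtering on Bob's side can only shrink the set of steered
operators. -/
lemma coneSteered_smul_conj_subset (ρ : Mat4) (f : Mat2) {r : ℝ} (hr : 0 < r) :
    coneSteered ((r : ℂ) • (((1 : Mat2) ⊗ₖ f) * ρ * ((1 : Mat2) ⊗ₖ f)ᴴ)) ⊆ coneSteered ρ := by
  rintro τ ⟨E, hE, t, ht, htr, rfl⟩
  have key : trB (((1 : Mat2) ⊗ₖ E) * ((r : ℂ) • (((1 : Mat2) ⊗ₖ f) * ρ * ((1 : Mat2) ⊗ₖ f)ᴴ))) =
      trB (((1 : Mat2) ⊗ₖ ((r : ℂ) • (fᴴ * E * f))) * ρ) := by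
    rw [Matrix.mul_smul, trB_smul, trB_one_kronecker_mul_conj, kronecker_smul,
      Matrix.smul_mul, trB_smul]
  refine ⟨(r : ℂ) • (fᴴ * E * f),
    (hE.conjTranspose_mul_mul_same f).smul (by exact_mod_cast hr.le), t, ht, ?_, by rw [key]⟩
  rw [← htr, ← trace_trB, ← key, trace_trB]

/-- The normalization of the Bob-filtered state is positive. -/
lemma exists_pos_filterB_norm {ρ : Mat4} (hρ : IsState ρ) {f : Mat2} (hf : IsUnit f) :
    ∃ N : ℝ, 0 < N ∧ (((1 : Mat2) ⊗ₖ (fᴴ * f)) * ρ).trace = (N : ℂ) := by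
  have htr : (((1 : Mat2) ⊗ₖ (fᴴ * f)) * ρ).trace =
      (((1 : Mat2) ⊗ₖ f) * ρ * ((1 : Mat2) ⊗ₖ f)ᴴ).trace := by
    have h := trB_one_kronecker_mul_conj 1 f ρ
    rw [one_kronecker_one, Matrix.one_mul, Matrix.mul_one] at h
    rw [← trace_trB, ← h, trace_trB]
  have hpsd := hρ.1.mul_mul_conjTranspose_same ((1 : Mat2) ⊗ₖ f)
  have hne : (((1 : Mat2) ⊗ₖ f) * ρ * ((1 : Mat2) ⊗ₖ f)ᴴ).trace ≠ 0 := by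
    intro h0
    have hu : IsUnit ((1 : Mat2) ⊗ₖ f) := by
      rw [Matrix.isUnit_iff_isUnit_det] at hf ⊢
      rw [det_kronecker]
      simpa using hf
    have hz := hpsd.trace_eq_zero_iff.1 h0
    rw [← star_eq_conjTranspose, hu.star.mul_left_eq_zero, hu.mul_right_eq_zero] at hz
    simpa [hz] using hρ.2
  obtain ⟨h₁, h₂⟩ := Complex.lt_def.1 (hpsd.trace_nonneg.lt_of_ne' hne)
  exact ⟨_, h₁, htr.trans (Complex.ext rfl h₂.symm)⟩

/-- the set of Alice's steered states is invariant under Bob-side filtering. -/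
theorem stmt_0 (ρ : Mat4) (hρ : IsState ρ) (fB : Mat2) (hfB : IsUnit fB) :
    {τ : Mat2 | ∃ E : Mat2, E.PosSemidef ∧ ((1 : Mat2) - E).PosSemidef ∧
      ∃ t : ℝ, 0 < t ∧ (((1 : Mat2) ⊗ₖ E) * ρ).trace = (t : ℂ) ∧
        τ = ((t : ℂ))⁻¹ • trB (((1 : Mat2) ⊗ₖ E) * ρ)} =
    {τ : Mat2 | ∃ E : Mat2, E.PosSemidef ∧ ((1 : Mat2) - E).PosSemidef ∧
      ∃ t : ℝ, 0 < t ∧ (((1 : Mat2) ⊗ₖ E) * filterB ρ fB).trace = (t : ℂ) ∧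
        τ = ((t : ℂ))⁻¹ • trB (((1 : Mat2) ⊗ₖ E) * filterB ρ fB)} := by
  obtain ⟨N, hN, hNtr⟩ := exists_pos_filterB_norm hρ hfB
  have hfilter : filterB ρ fB =
      ((N⁻¹ : ℝ) : ℂ) • (((1 : Mat2) ⊗ₖ fB) * ρ * ((1 : Mat2) ⊗ₖ fB)ᴴ) := by
    rw [filterB, hNtr, Complex.ofReal_inv]
  have hinv : (N : ℂ) • (((1 : Mat2) ⊗ₖ fB⁻¹) * filterB ρ fB * ((1 : Mat2) ⊗ₖ fB⁻¹)ᴴ) = ρ := by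
    have hone : ((1 : Mat2) ⊗ₖ fB⁻¹) * ((1 : Mat2) ⊗ₖ fB) = 1 := by
      rw [← mul_kronecker_mul, nonsing_inv_mul _ ((isUnit_iff_isUnit_det _).1 hfB),
        Matrix.one_mul, one_kronecker_one]
    have hone' : ((1 : Mat2) ⊗ₖ fB)ᴴ * ((1 : Mat2) ⊗ₖ fB⁻¹)ᴴ = 1 := by
      rw [← conjTranspose_mul, hone, conjTranspose_one]
    have hN' : (N : ℂ) * (N : ℂ)⁻¹ = 1 := mul_inv_cancel₀ (by exact_mod_cast hN.ne')
    rw [hfilter, Matrix.mul_smul, Matrix.smul_mul, smul_smul, Complex.ofReal_inv, hN', one_smul,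
      ← Matrix.mul_assoc, ← Matrix.mul_assoc, hone, Matrix.one_mul, Matrix.mul_assoc, hone',
      Matrix.mul_one]
  rw [steered_eq_coneSteered, steered_eq_coneSteered]
  apply Set.Subset.antisymm
  · conv_lhs => rw [← hinv]
    exact coneSteered_smul_conj_subset _ _ hN
  · rw [hfilter]
    exact coneSteered_smul_conj_subset _ _ (inv_pos.2 hN)

end
end

section
/- Let ρ be a two-qubit state with ‖b(ρ)‖ < 1, let f_B be an invertible 2×2 complex matrix, and let ρ'_FB = (𝟙⊗f_B)ρ(𝟙⊗f_B)†/tr[(𝟙⊗f_B†f_B)ρ] be the Bob-filtered state; assume also ‖b(ρ'_FB)‖ < 1. Then Alice's quantum steering ellipsoid centre is invariant: c_A(ρ'_FB) = c_A(ρ). -/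
open Matrix Kronecker Complex
open scoped ComplexOrder

noncomputable section

/-- Bob's unnormalised conditional operator `tr_A((A ⊗ 𝟙)ρ)`. -/
def bobCond (A : Mat2) (ρ : Mat4) : Mat2 := trA ((A ⊗ₖ (1 : Mat2)) * ρ)

/-- The polarised determinant `tr X tr Y - tr (XY)` of two 2×2 matrices. -/
def polarDet (X Y : Mat2) : ℂ := X.trace * Y.trace - (X * Y).trace

lemma bobCond_apply (A : Mat2) (ρ : Mat4) (k l : Fin 2) :
    bobCond A ρ k l = ∑ i, ∑ j, A i j * ρ (j, k) (i, l) := by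
  simp [bobCond, trA, Matrix.mul_apply, Fintype.sum_prod_type, Matrix.one_apply]

lemma trace_kronecker_mul (A B : Mat2) (ρ : Mat4) :
    ((A ⊗ₖ B) * ρ).trace = (B * bobCond A ρ).trace := by
  simp only [bobCond_apply, Matrix.trace, Matrix.diag, Matrix.mul_apply, Fintype.sum_prod_type,
    Fin.sum_univ_two, kroneckerMap_apply]
  ring

lemma bobCond_smul (A : Mat2) (c : ℂ) (ρ : Mat4) : bobCond A (c • ρ) = c • bobCond A ρ := by
  ext k l
  simp [bobCond_apply]
  ring

lemma bobCond_conj (A f : Mat2) (ρ : Mat4) :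
    bobCond A (((1 : Mat2) ⊗ₖ f) * ρ * ((1 : Mat2) ⊗ₖ f)ᴴ) = f * bobCond A ρ * fᴴ := by
  ext k l
  simp [bobCond_apply, Matrix.mul_apply, Fintype.sum_prod_type, Matrix.one_apply]
  ring

lemma bobCond_isHermitian {A : Mat2} {ρ : Mat4} (hA : A.IsHermitian) (hρ : ρ.IsHermitian) :
    (bobCond A ρ).IsHermitian := by
  refine Matrix.IsHermitian.ext fun k l => ?_
  simp only [bobCond_apply, star_sum, star_mul', hA.apply, hρ.apply]
  exact Finset.sum_comm

lemma trace_bobCond_one (ρ : Mat4) : (bobCond 1 ρ).trace = ρ.trace := by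
  simpa using (trace_kronecker_mul 1 1 ρ).symm

lemma pauli_isHermitian (i : Fin 3) : (pauli i).IsHermitian := by
  refine Matrix.IsHermitian.ext fun k l => ?_
  fin_cases i <;> fin_cases k <;> fin_cases l <;> simp [pauli]

lemma polarDet_smul (c : ℂ) (X Y : Mat2) :
    polarDet (c • X) (c • Y) = c ^ 2 * polarDet X Y := by
  simp [polarDet]
  ring

lemma polarDet_conj (f X Y : Mat2) :
    polarDet (f * X * fᴴ) (f * Y * fᴴ) = (normSq f.det : ℂ) * polarDet X Y := by
  rw [normSq_eq_conj_mul_self]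
  simp only [polarDet, Matrix.trace_fin_two, Matrix.mul_apply, Fin.sum_univ_two,
    Matrix.conjTranspose_apply, Matrix.det_fin_two, map_sub, map_mul, RCLike.star_def]
  ring

/-- The polarised determinant of Hermitian matrices in Bloch coordinates is the Minkowski form. -/
lemma two_mul_polarDet_re {X Y : Mat2} (hX : X.IsHermitian) (hY : Y.IsHermitian) :
    2 * (polarDet X Y).re = X.trace.re * Y.trace.re -
      ∑ j, (pauli j * X).trace.re * (pauli j * Y).trace.re := by
  have key : ∀ {Z : Mat2}, Z.IsHermitian → (Z 0 0).im = 0 ∧ (Z 1 1).im = 0 ∧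
      (Z 1 0).re = (Z 0 1).re ∧ (Z 1 0).im = -(Z 0 1).im := by
    intro Z hZ
    have h0 := congrArg Complex.im (hZ.apply 0 0)
    have h1 := congrArg Complex.im (hZ.apply 1 1)
    have h2 := congrArg Complex.re (hZ.apply 1 0)
    have h3 := congrArg Complex.im (hZ.apply 1 0)
    simp at h0 h1 h2 h3
    exact ⟨by linarith, by linarith, by linarith, by linarith⟩
  obtain ⟨x0, x1, x2, x3⟩ := key hX
  obtain ⟨y0, y1, y2, y3⟩ := key hY
  simp [polarDet, pauli, Fin.sum_univ_three, Matrix.trace_fin_two, Matrix.mul_apply,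
    Fin.sum_univ_two, x0, x1, x2, x3, y0, y1, y2, y3]
  ring

lemma polarDet_self_re_nonpos {X : Mat2} (hX : X.IsHermitian) (h : X.trace = 0) :
    (polarDet X X).re ≤ 0 := by
  have := two_mul_polarDet_re hX hX
  have hs : 0 ≤ ∑ j, (pauli j * X).trace.re * (pauli j * X).trace.re :=
    Finset.sum_nonneg fun j _ => mul_self_nonneg _
  simp only [h, Complex.zero_re] at this
  linarith

lemma one_sub_norm3_bVec_sq {ρ : Mat4} (hρ : ρ.IsHermitian) (htr : ρ.trace = 1) :
    1 - norm3 (bVec ρ) ^ 2 = 2 * (polarDet (bobCond 1 ρ) (bobCond 1 ρ)).re := by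
  have h1 := bobCond_isHermitian Matrix.isHermitian_one hρ
  rw [two_mul_polarDet_re h1 h1, trace_bobCond_one, htr, norm3,
    Real.sq_sqrt (Finset.sum_nonneg fun i _ => sq_nonneg _)]
  simp [bVec, trace_kronecker_mul, sq]

/-- The steering ellipsoid centre as a ratio of polarised determinants. -/
lemma cA_apply {ρ : Mat4} (hρ : ρ.IsHermitian) (htr : ρ.trace = 1) (i : Fin 3) :
    cA ρ i = (polarDet (bobCond (pauli i) ρ) (bobCond 1 ρ)).re /
      (polarDet (bobCond 1 ρ) (bobCond 1 ρ)).re := by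
  have h1 := bobCond_isHermitian Matrix.isHermitian_one hρ
  have h2 := two_mul_polarDet_re (bobCond_isHermitian (pauli_isHermitian i) hρ) h1
  have h3 : (aVec ρ - Tmat ρ *ᵥ bVec ρ) i =
      2 * (polarDet (bobCond (pauli i) ρ) (bobCond 1 ρ)).re := by
    rw [h2, trace_bobCond_one, htr]
    simp [aVec, bVec, Tmat, Matrix.mulVec, dotProduct, trace_kronecker_mul]
  rw [cA, Pi.smul_apply, h3, one_sub_norm3_bVec_sq hρ htr, smul_eq_mul, ← div_eq_inv_mul,
    mul_div_mul_left _ _ two_ne_zero]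

/-- Alice's QSE centre is invariant under Bob-side local filtering. -/
theorem stmt_1 (ρ : Mat4) (hρ : IsState ρ) (hb : norm3 (bVec ρ) < 1)
    (fB : Mat2) (hfB : IsUnit fB) (hb' : norm3 (bVec (filterB ρ fB)) < 1) :
    cA (filterB ρ fB) = cA ρ := by
  obtain ⟨hpos, htr⟩ := hρ
  have hH : ρ.IsHermitian := hpos.1
  have hD : 0 < (polarDet (bobCond 1 ρ) (bobCond 1 ρ)).re := by
    have h := one_sub_norm3_bVec_sq hH htr
    have h0 : 0 ≤ norm3 (bVec ρ) := Real.sqrt_nonneg _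
    nlinarith
  have hdet : 0 < normSq fB.det :=
    normSq_pos.mpr ((Matrix.isUnit_iff_isUnit_det _).mp hfB).ne_zero
  set σ : Mat4 := ((1 : Mat2) ⊗ₖ fB) * ρ * ((1 : Mat2) ⊗ₖ fB)ᴴ with hσ
  have hσH : σ.IsHermitian := Matrix.isHermitian_mul_mul_conjTranspose _ hH
  have hpol (A : Mat2) : polarDet (bobCond A σ) (bobCond 1 σ) =
      (normSq fB.det : ℂ) * polarDet (bobCond A ρ) (bobCond 1 ρ) := by
    rw [hσ, bobCond_conj, bobCond_conj, polarDet_conj]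
  have hN : (((1 : Mat2) ⊗ₖ (fBᴴ * fB)) * ρ).trace = σ.trace := by
    rw [trace_kronecker_mul, ← trace_bobCond_one σ, hσ, bobCond_conj, Matrix.trace_mul_comm,
      Matrix.mul_assoc, ← Matrix.trace_mul_comm, Matrix.mul_assoc, Matrix.trace_mul_comm,
      Matrix.mul_assoc]
  have hN0 : σ.trace ≠ 0 := by
    intro h0
    have h := polarDet_self_re_nonpos (bobCond_isHermitian Matrix.isHermitian_one hσH)
      ((trace_bobCond_one σ).trans h0)
    rw [hpol, Complex.re_ofReal_mul] at h
    exact absurd h (not_le.mpr (mul_pos hdet hD))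
  obtain ⟨r, hr⟩ : ∃ r : ℝ, (r : ℂ) = σ.trace := by
    refine Complex.conj_eq_iff_real.mp ?_ |>.imp fun r h => h.symm
    rw [starRingEnd_apply, ← Matrix.trace_conjTranspose, hσH.eq]
  have hr0 : r ≠ 0 := by
    rintro rfl
    exact hN0 (by simpa using hr.symm)
  have hfil : filterB ρ fB = ((r⁻¹ : ℝ) : ℂ) • σ := by
    rw [filterB, hN, ← hr, Complex.ofReal_inv]
  have hpol' (A : Mat2) : (polarDet (bobCond A (filterB ρ fB)) (bobCond 1 (filterB ρ fB))).re =
      (r⁻¹ ^ 2 * normSq fB.det) * (polarDet (bobCond A ρ) (bobCond 1 ρ)).re := by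
    rw [hfil, bobCond_smul, bobCond_smul, polarDet_smul, hpol, ← mul_assoc, ← Complex.ofReal_pow,
      ← Complex.ofReal_mul, Complex.re_ofReal_mul]
  have hfH : (filterB ρ fB).IsHermitian := by
    rw [hfil, Matrix.IsHermitian, Matrix.conjTranspose_smul, hσH.eq, RCLike.star_def,
      Complex.conj_ofReal]
  have hftr : (filterB ρ fB).trace = 1 := by
    rw [hfil, Matrix.trace_smul, ← hr, smul_eq_mul, ← Complex.ofReal_mul, inv_mul_cancel₀ hr0,
      Complex.ofReal_one]
  ext i
  rw [cA_apply hfH hftr, cA_apply hH htr, hpol', hpol', mul_div_mul_left]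
  positivity

end
end

section
/- (Result 1, Alice-side.) Assume the QSE conjecture in the form: for every two-qubit state σ with ‖a(σ)‖ < 1, B(σ) ≤ max(√(2(1−‖c_B(σ)‖)), 1). Let ρ be a two-qubit state with ‖a(ρ)‖ < 1 and ‖c_B(ρ)‖ > 1/2. Then for every invertible 2×2 complex matrix f_A such that ‖a(ρ'_FA)‖ < 1, the Alice-filtered state satisfies B(ρ'_FA) ≤ 1; that is, Alice alone cannot reveal any hidden CHSH-inequality violation of ρ. -/
open Matrix Kronecker Complex
open scoped ComplexOrder

noncomputable section

lemma trB_conj (ρ : Mat4) (f : Mat2) :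
    trB ((f ⊗ₖ (1 : Mat2)) * ρ * (f ⊗ₖ (1 : Mat2))ᴴ) = f * trB ρ * fᴴ := by
  ext i j
  fin_cases i <;> fin_cases j <;>
  simp [trB, Matrix.mul_apply, Fintype.sum_prod_type, kroneckerMap_apply,
      Matrix.one_apply] <;> ring

lemma trace_conj (ρ : Mat4) (f : Mat2) :
    ((f ⊗ₖ (1 : Mat2)) * ρ * (f ⊗ₖ (1 : Mat2))ᴴ).trace
      = (((fᴴ * f) ⊗ₖ (1 : Mat2)) * ρ).trace := by
  rw [Matrix.trace_mul_comm, ← Matrix.mul_assoc, conjTranspose_kronecker, ← mul_kronecker_mul]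
  simp

lemma adjugate_conj_trace (ρ : Mat4) (f P : Mat2) :
    (((f * trB ρ * fᴴ).adjugate ⊗ₖ P) *
        ((f ⊗ₖ (1 : Mat2)) * ρ * (f ⊗ₖ (1 : Mat2))ᴴ)).trace
      = (f.det * star f.det) * (((trB ρ).adjugate ⊗ₖ P) * ρ).trace := by
  have h : (fᴴ ⊗ₖ (1 : Mat2)) * ((f * trB ρ * fᴴ).adjugate ⊗ₖ P) * (f ⊗ₖ (1 : Mat2))
      = (f.det * star f.det) • ((trB ρ).adjugate ⊗ₖ P) := by
    rw [← mul_kronecker_mul, ← mul_kronecker_mul, adjugate_mul_distrib, adjugate_mul_distrib,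
      ← Matrix.mul_assoc, mul_adjugate, Matrix.mul_assoc, Matrix.mul_assoc, adjugate_mul,
      det_conjTranspose]
    simp [smul_kronecker, smul_smul]
  rw [conjTranspose_kronecker, conjTranspose_one, ← Matrix.mul_assoc, Matrix.trace_mul_comm,
    ← Matrix.mul_assoc, ← Matrix.mul_assoc, h, smul_mul, trace_smul, smul_eq_mul]

/-- The reduced state satisfies `2 adj(ρ_A) = 1 - a·σ`. -/
lemma two_smul_adjugate_trB {ρ : Mat4} (hρ : IsState ρ) :
    (2 : ℂ) • (trB ρ).adjugate = 1 - obs (aVec ρ) := by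
  obtain ⟨h, ht⟩ := hρ
  have H : ∀ p q, star (ρ q p) = ρ p q := fun p q => h.1.apply p q
  have e (p q) : (ρ q p).re = (ρ p q).re := by simpa using congrArg Complex.re (H p q)
  have m (p q) : (ρ q p).im = -(ρ p q).im := by
    have := congrArg Complex.im (H p q)
    simp at this
    linarith
  have e1 := e (0, 0) (1, 0)
  have e2 := e (0, 1) (1, 1)
  have m1 := m (0, 0) (1, 0)
  have m2 := m (0, 1) (1, 1)
  have d1 := m (0, 0) (0, 0)
  have d2 := m (0, 1) (0, 1)
  have d3 := m (1, 0) (1, 0)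
  have d4 := m (1, 1) (1, 1)
  have t := congrArg Complex.re ht
  simp [Matrix.trace, Fintype.sum_prod_type] at t
  ext i j
  fin_cases i <;> fin_cases j <;> apply Complex.ext <;>
  simp [adjugate_fin_two, trB, obs, aVec, pauli, Fin.sum_univ_three, Matrix.trace,
    Matrix.mul_apply, Fintype.sum_prod_type, kroneckerMap_apply, Matrix.one_apply] <;>
  linarith

lemma four_mul_det_trB {ρ : Mat4} (hρ : IsState ρ) :
    4 * (trB ρ).det.re = 1 - norm3 (aVec ρ) ^ 2 := by
  have h := congrArg Matrix.det (two_smul_adjugate_trB hρ)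
  rw [det_smul, det_adjugate] at h
  have h' := congrArg Complex.re h
  rw [norm3, Real.sq_sqrt (Finset.sum_nonneg fun i _ => sq_nonneg _)]
  simp [det_fin_two, obs, pauli, Fin.sum_univ_three, pow_two] at h' ⊢
  linarith

lemma two_mul_adjugate_trace {ρ : Mat4} (hρ : IsState ρ) (j : Fin 3) :
    2 * (((trB ρ).adjugate ⊗ₖ pauli j) * ρ).trace.re
      = (bVec ρ - (Tmat ρ)ᵀ *ᵥ aVec ρ) j := by
  have h : (2 : ℂ) * (((trB ρ).adjugate ⊗ₖ pauli j) * ρ).trace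
      = (((1 - obs (aVec ρ)) ⊗ₖ pauli j) * ρ).trace := by
    rw [← two_smul_adjugate_trB hρ, smul_kronecker, smul_mul, trace_smul, smul_eq_mul]
  have h' := congrArg Complex.re h
  have hsub : (1 - obs (aVec ρ)) ⊗ₖ pauli j
      = (1 : Mat2) ⊗ₖ pauli j - ∑ i, (aVec ρ i : ℂ) • (pauli i ⊗ₖ pauli j) := by
    ext p q
    simp [obs, kroneckerMap_apply, Fin.sum_univ_three]
    ring
  rw [hsub] at h'
  simp [Matrix.sub_mul, Matrix.add_mul, Fin.sum_univ_three] at h'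
  rw [h']
  simp [bVec, Tmat, mulVec, dotProduct, Fin.sum_univ_three]
  ring

/-- Bob's ellipsoid centre as a ratio of quantities that are homogeneous under Alice's filters. -/
lemma cB_apply {ρ : Mat4} (hρ : IsState ρ) (j : Fin 3) :
    cB ρ j = (4 * (trB ρ).det.re)⁻¹ * (2 * (((trB ρ).adjugate ⊗ₖ pauli j) * ρ).trace.re) := by
  rw [two_mul_adjugate_trace hρ, four_mul_det_trB hρ]
  rfl

lemma filter_trace_pos {ρ : Mat4} (hρ : IsState ρ) {f : Mat2} (hf : IsUnit f) :
    0 < (((fᴴ * f) ⊗ₖ (1 : Mat2)) * ρ).trace := by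
  rw [← trace_conj]
  have hp := hρ.1.mul_mul_conjTranspose_same (f ⊗ₖ (1 : Mat2))
  refine lt_of_le_of_ne hp.trace_nonneg fun h0 => ?_
  have hz := hp.trace_eq_zero_iff.1 h0.symm
  have hu : IsUnit (f ⊗ₖ (1 : Mat2)) := by
    rw [isUnit_iff_isUnit_det] at hf ⊢
    rw [det_kronecker]
    simpa using hf
  have hρ0 : ρ = 0 := by
    have hu' : IsUnit (f ⊗ₖ (1 : Mat2))ᴴ := hu.star
    exact hu.mul_right_eq_zero.1 (hu'.mul_left_eq_zero.1 hz)
  have := hρ.2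
  simp [hρ0] at this

lemma IsState.filterA {ρ : Mat4} (hρ : IsState ρ) {f : Mat2} (hf : IsUnit f) :
    IsState (filterA ρ f) := by
  have hN := filter_trace_pos hρ hf
  refine ⟨(hρ.1.mul_mul_conjTranspose_same _).smul (inv_nonneg.2 hN.le), ?_⟩
  rw [_root_.filterA, trace_smul, trace_conj, smul_eq_mul, inv_mul_cancel₀ hN.ne']

/-- Bob's ellipsoid centre is invariant under invertible filters on Alice's side. -/
lemma cB_filterA {ρ : Mat4} (hρ : IsState ρ) {f : Mat2} (hf : IsUnit f) :
    cB (filterA ρ f) = cB ρ := by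
  ext j
  rw [cB_apply (hρ.filterA hf), cB_apply hρ]
  have hN := filter_trace_pos hρ hf
  have hdet : f.det ≠ 0 := ((isUnit_iff_isUnit_det f).1 hf).ne_zero
  have hn : Complex.normSq f.det ≠ 0 := by simpa using hdet
  unfold filterA
  set N := (((fᴴ * f) ⊗ₖ (1 : Mat2)) * ρ).trace
  obtain ⟨n, hn0, hnN⟩ : ∃ n : ℝ, n ≠ 0 ∧ N = n := by
    obtain ⟨h1, h2⟩ := Complex.pos_iff.1 hN
    exact ⟨N.re, h1.ne', Complex.ext rfl h2.symm⟩
  have hT : trB (N⁻¹ • ((f ⊗ₖ (1 : Mat2)) * ρ * (f ⊗ₖ (1 : Mat2))ᴴ))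
      = N⁻¹ • (f * trB ρ * fᴴ) := by
    rw [← trB_conj]
    ext i k
    simp [trB, mul_add]
  obtain ⟨r, hr0, hr⟩ : ∃ r : ℝ, r ≠ 0 ∧ N⁻¹ * (N⁻¹ * (f.det * star f.det)) = r :=
    ⟨n⁻¹ * (n⁻¹ * Complex.normSq f.det), by positivity, by
      rw [hnN, ← starRingEnd_apply, Complex.mul_conj]; push_cast; rfl⟩
  have hD : (N⁻¹ • (f * trB ρ * fᴴ)).det = r * (trB ρ).det := by
    rw [← hr, det_smul, det_mul, det_mul, det_conjTranspose, Fintype.card_fin]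
    ring
  have hA : (((N⁻¹ • (f * trB ρ * fᴴ)).adjugate ⊗ₖ pauli j) *
      (N⁻¹ • ((f ⊗ₖ (1 : Mat2)) * ρ * (f ⊗ₖ (1 : Mat2))ᴴ))).trace
      = r * (((trB ρ).adjugate ⊗ₖ pauli j) * ρ).trace := by
    rw [adjugate_smul, smul_kronecker, smul_mul, Matrix.mul_smul, trace_smul, trace_smul,
      adjugate_conj_trace, ← hr]
    simp only [Fintype.card_fin, smul_eq_mul]
    ring
  rw [hT, hD, hA, Complex.re_ofReal_mul, Complex.re_ofReal_mul]
  field_simp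

/-- Result 1, Alice-side: assuming the QSE conjecture, if ‖c_B(ρ)‖ > 1/2 then
Alice alone cannot reveal any hidden CHSH-inequality violation. -/
theorem stmt_4
    (conj : ∀ σ : Mat4, IsState σ → norm3 (aVec σ) < 1 →
      Bval σ ≤ max (Real.sqrt (2 * (1 - norm3 (cB σ)))) 1)
    (ρ : Mat4) (hρ : IsState ρ) (ha : norm3 (aVec ρ) < 1)
    (hc : 1 / 2 < norm3 (cB ρ)) :
    ∀ fA : Mat2, IsUnit fA → norm3 (aVec (filterA ρ fA)) < 1 →
      Bval (filterA ρ fA) ≤ 1 := by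
  intro f hf hf1
  have h := conj _ (hρ.filterA hf) hf1
  rw [cB_filterA hρ hf] at h
  refine h.trans (max_le (Real.sqrt_le_one.2 ?_) le_rfl)
  linarith

end
end

section
/- (Result 2, Bob-side.) Let c₀ ∈ ℝ and assume the F₃ version of the QSE conjecture in the form: for every two-qubit state σ with ‖b(σ)‖ < 1 and ‖c_A(σ)‖ > c₀, one has F₃(σ) ≤ 1. Let ρ be a two-qubit state with ‖b(ρ)‖ < 1 and ‖c_A(ρ)‖ > c₀. Then for every invertible 2×2 complex matrix f_B such that ‖b(ρ'_FB)‖ < 1, the Bob-filtered state satisfies F₃(ρ'_FB) ≤ 1; that is, Bob alone cannot reveal any hidden F₃-inequality violation of ρ. -/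
open Matrix Kronecker Complex
open scoped ComplexOrder

noncomputable section

/-- The partial trace over Alice commutes with conjugation by a Bob-side operator. -/
lemma trA_conj_one_kronecker (M : Mat4) (f : Mat2) :
    trA (((1 : Mat2) ⊗ₖ f) * M * ((1 : Mat2) ⊗ₖ f)ᴴ) = f * trA M * fᴴ := by
  ext i j
  simp only [trA, of_apply, mul_apply, Fintype.sum_prod_type, Fin.sum_univ_two,
    kroneckerMap_apply, conjTranspose_apply, one_apply_eq, one_apply_ne, ne_eq, zero_ne_one,
    one_ne_zero, not_false_eq_true, star_mul', star_one, star_zero]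
  ring

/-- The trace of the conjugated operator, in the form used in `filterB`. -/
lemma trace_conj_one_kronecker (M : Mat4) (f : Mat2) :
    (((1 : Mat2) ⊗ₖ f) * M * ((1 : Mat2) ⊗ₖ f)ᴴ).trace
      = (((1 : Mat2) ⊗ₖ (fᴴ * f)) * M).trace := by
  rw [trace_mul_comm, ← Matrix.mul_assoc, conjTranspose_kronecker, ← mul_kronecker_mul]
  simp

/-- A homogeneous complex form of the steering ellipsoid centre (up to a factor `2`). -/
def ellipsoidCentre (M : Mat4) (i : Fin 3) : ℂ :=
  ((trA M).det)⁻¹ * ((pauli i ⊗ₖ (trA M).adjugate) * M).trace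

lemma ellipsoidCentre_smul {c : ℂ} (hc : c ≠ 0) (M : Mat4) (i : Fin 3) :
    ellipsoidCentre (c • M) i = ellipsoidCentre M i := by
  have h : trA (c • M) = c • trA M := by
    ext i j
    simp [trA, mul_add]
  simp only [ellipsoidCentre, h, det_smul, adjugate_smul, kronecker_smul, Matrix.smul_mul,
    Matrix.mul_smul, trace_smul, Fintype.card_fin, Nat.add_one_sub_one, pow_one,
    smul_eq_mul]
  field_simp

lemma ellipsoidCentre_conj {f : Mat2} (hf : IsUnit f) (M : Mat4) (i : Fin 3) :
    ellipsoidCentre (((1 : Mat2) ⊗ₖ f) * M * ((1 : Mat2) ⊗ₖ f)ᴴ) i = ellipsoidCentre M i := by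
  have hd : f.det ≠ 0 := ((isUnit_iff_isUnit_det f).1 hf).ne_zero
  have hd' : star f.det ≠ 0 := star_ne_zero.2 hd
  have key : (pauli i ⊗ₖ (f * trA M * fᴴ).adjugate)
        * (((1 : Mat2) ⊗ₖ f) * M * ((1 : Mat2) ⊗ₖ f)ᴴ)
      = ((pauli i ⊗ₖ (fᴴ.adjugate * ((trA M).adjugate * (f.adjugate * f)))) * M)
        * ((1 : Mat2) ⊗ₖ fᴴ) := by
    rw [conjTranspose_kronecker, conjTranspose_one, ← Matrix.mul_assoc, ← Matrix.mul_assoc,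
      ← mul_kronecker_mul, adjugate_mul_distrib, adjugate_mul_distrib]
    simp only [Matrix.mul_one, Matrix.mul_assoc]
  have key' : (((pauli i ⊗ₖ (fᴴ.adjugate * ((trA M).adjugate * (f.adjugate * f)))) * M)
        * ((1 : Mat2) ⊗ₖ fᴴ)).trace
      = star f.det * f.det * ((pauli i ⊗ₖ (trA M).adjugate) * M).trace := by
    rw [trace_mul_comm, ← Matrix.mul_assoc, ← mul_kronecker_mul, ← Matrix.mul_assoc,
      mul_adjugate, adjugate_mul, det_conjTranspose]
    simp only [Matrix.one_mul, Matrix.mul_smul, Matrix.smul_mul, Matrix.mul_one,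
      kronecker_smul, trace_smul, smul_eq_mul]
    ring
  rw [ellipsoidCentre, ellipsoidCentre, trA_conj_one_kronecker, key, key', det_mul, det_mul,
    det_conjTranspose]
  field_simp

lemma two_smul_adjugate_trA {ρ : Mat4} (hρ : IsState ρ) :
    (2 : ℂ) • (trA ρ).adjugate = 1 - obs (bVec ρ) := by
  have ht := hρ.2
  have h := fun x y => hρ.1.isHermitian.apply x y
  have h01 := h (0, 0) (0, 1)
  have h11 := h (1, 0) (1, 1)
  have h0 := h (0, 0) (0, 0)
  have h1 := h (0, 1) (0, 1)
  have h2 := h (1, 0) (1, 0)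
  have h3 := h (1, 1) (1, 1)
  simp only [trace, diag, Fintype.sum_prod_type, Fin.sum_univ_two, Complex.ext_iff] at *
  ext i j
  fin_cases i <;> fin_cases j <;>
    simp [adjugate_fin_two, trA, obs, bVec, pauli, trace, mul_apply, Fintype.sum_prod_type,
      Fin.sum_univ_two, Fin.sum_univ_three, Complex.ext_iff, one_apply] at * <;>
    constructor <;> linarith

lemma four_mul_det_trA {ρ : Mat4} (hρ : IsState ρ) :
    4 * (trA ρ).det = ((1 - norm3 (bVec ρ) ^ 2 : ℝ) : ℂ) := by
  have h := congrArg det (two_smul_adjugate_trA hρ)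
  rw [det_smul, det_adjugate] at h
  simp only [Fintype.card_fin, Nat.add_one_sub_one, pow_one] at h
  have hn : norm3 (bVec ρ) ^ 2 = ∑ i, bVec ρ i ^ 2 :=
    Real.sq_sqrt (Finset.sum_nonneg fun i _ => sq_nonneg _)
  have h4 : (4 : ℂ) = 2 ^ 2 := by norm_num
  rw [hn, h4, h]
  simp [det_fin_two, obs, pauli, Fin.sum_univ_three]
  linear_combination ((bVec ρ 1 : ℂ) ^ 2) * Complex.I_sq

lemma aVec_sub_Tmat_mulVec_bVec {ρ : Mat4} (hρ : IsState ρ) (i : Fin 3) :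
    (aVec ρ - Tmat ρ *ᵥ bVec ρ) i = 2 * ((pauli i ⊗ₖ (trA ρ).adjugate) * ρ).trace.re := by
  have h : 2 * ((pauli i ⊗ₖ (trA ρ).adjugate) * ρ).trace
      = ((pauli i ⊗ₖ (1 - obs (bVec ρ))) * ρ).trace := by
    rw [← two_smul_adjugate_trA hρ, kronecker_smul, Matrix.smul_mul, trace_smul, smul_eq_mul]
  have hsub : pauli i ⊗ₖ (1 - obs (bVec ρ))
      = pauli i ⊗ₖ (1 : Mat2) - ∑ j, (bVec ρ j : ℂ) • (pauli i ⊗ₖ pauli j) := by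
    ext x y
    simp [obs, Matrix.sum_apply, mul_sub, Finset.mul_sum, mul_left_comm]
  have h2 := congrArg Complex.re h
  rw [hsub, Matrix.sub_mul, Matrix.sum_mul, trace_sub, trace_sum] at h2
  simp only [Matrix.smul_mul, trace_smul, smul_eq_mul, Complex.sub_re, Complex.re_sum,
    Complex.re_ofReal_mul] at h2
  rw [show (2 : ℂ) = ((2 : ℝ) : ℂ) by norm_num, Complex.re_ofReal_mul] at h2
  rw [h2]
  simp [aVec, Tmat, mulVec, dotProduct, mul_comm]

lemma cA_apply_eq_ellipsoidCentre {ρ : Mat4} (hρ : IsState ρ) (i : Fin 3) :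
    cA ρ i = (ellipsoidCentre ρ i).re / 2 := by
  have hd : (trA ρ).det = (((1 - norm3 (bVec ρ) ^ 2) / 4 : ℝ) : ℂ) := by
    have := four_mul_det_trA hρ
    push_cast at this ⊢
    linear_combination this / 4
  rw [ellipsoidCentre, hd, ← Complex.ofReal_inv, Complex.re_ofReal_mul, cA, Pi.smul_apply,
    aVec_sub_Tmat_mulVec_bVec hρ, smul_eq_mul, inv_div]
  ring

lemma trace_filterB_ne_zero {ρ : Mat4} (hρ : IsState ρ) {f : Mat2} (hf : IsUnit f) :
    (((1 : Mat2) ⊗ₖ (fᴴ * f)) * ρ).trace ≠ 0 := by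
  intro h0
  rw [← trace_conj_one_kronecker,
    (hρ.1.mul_mul_conjTranspose_same ((1 : Mat2) ⊗ₖ f)).trace_eq_zero_iff] at h0
  have hK : IsUnit ((1 : Mat2) ⊗ₖ f) := by
    rw [isUnit_iff_isUnit_det, det_kronecker]
    simpa using ((isUnit_iff_isUnit_det f).1 hf)
  have hK' : IsUnit ((1 : Mat2) ⊗ₖ f)ᴴ := by
    simpa [star_eq_conjTranspose] using hK.star
  rw [hK'.mul_left_eq_zero, hK.mul_right_eq_zero] at h0
  have := hρ.2
  simp [h0] at this

lemma isState_filterB {ρ : Mat4} (hρ : IsState ρ) {f : Mat2} (hf : IsUnit f) :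
    IsState (filterB ρ f) := by
  have hp := hρ.1.mul_mul_conjTranspose_same ((1 : Mat2) ⊗ₖ f)
  refine ⟨?_, ?_⟩
  · refine hp.smul ?_
    rw [← trace_conj_one_kronecker]
    exact inv_nonneg.2 hp.trace_nonneg
  · rw [filterB, trace_smul, trace_conj_one_kronecker, smul_eq_mul]
    exact inv_mul_cancel₀ (trace_filterB_ne_zero hρ hf)

/-- Alice's steering ellipsoid centre is invariant under invertible Bob-side filters. -/
lemma cA_filterB {ρ : Mat4} (hρ : IsState ρ) {f : Mat2} (hf : IsUnit f) :
    cA (filterB ρ f) = cA ρ := by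
  ext i
  rw [cA_apply_eq_ellipsoidCentre (isState_filterB hρ hf), cA_apply_eq_ellipsoidCentre hρ, filterB,
    ellipsoidCentre_smul (inv_ne_zero (trace_filterB_ne_zero hρ hf)), ellipsoidCentre_conj hf]

/-- Result 2, Bob-side: assuming the F₃ form of the QSE conjecture with
threshold c₀, if ‖c_A(ρ)‖ > c₀ then Bob alone cannot reveal any hidden F₃ violation. -/
theorem stmt_5 (c₀ : ℝ)
    (conj : ∀ σ : Mat4, IsState σ → norm3 (bVec σ) < 1 → c₀ < norm3 (cA σ) →
      F3val σ ≤ 1)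
    (ρ : Mat4) (hρ : IsState ρ) (hb : norm3 (bVec ρ) < 1)
    (hc : c₀ < norm3 (cA ρ)) :
    ∀ fB : Mat2, IsUnit fB → norm3 (bVec (filterB ρ fB)) < 1 →
      F3val (filterB ρ fB) ≤ 1 := by
  intro fB hfB hb'
  exact conj _ (isState_filterB hρ hfB) hb' (by rwa [cA_filterB hρ hfB])

end
end

section
/- Let ρ be a two-qubit state with ‖a(ρ)‖ < 1 whose quantum steering ellipsoid matrix Q_B(ρ) is invertible. Then for every unit vector γ ∈ ℝ³ with 1 + a(ρ)·γ > 0, the steered Bloch vector b(γ) = (b(ρ) + T(ρ)ᵀγ)/(1 + a(ρ)·γ) lies on the surface of Bob's quantum steering ellipsoid: (b(γ) − c_B(ρ))ᵀ Q_B(ρ)⁻¹ (b(γ) − c_B(ρ)) = 1. -/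
open Matrix Kronecker Complex
open scoped ComplexOrder

noncomputable section

/-- The quadratic form of `(Mᵀ N M)⁻¹` pulls back along `Mᵀ` to the one of the inverse of `N`. -/
theorem dotProduct_congruence_inv_mulVec {n R : Type*} [Fintype n] [DecidableEq n] [CommRing R]
    {M N N' : Matrix n n R} (hN : N * N' = 1) (hQ : IsUnit (Mᵀ * N * M)) (w : n → R) :
    (Mᵀ *ᵥ w) ⬝ᵥ ((Mᵀ * N * M)⁻¹ *ᵥ (Mᵀ *ᵥ w)) = w ⬝ᵥ (N' *ᵥ w) := by
  have hM : IsUnit M.det := by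
    rw [Matrix.isUnit_iff_isUnit_det, det_mul] at hQ
    exact isUnit_of_mul_isUnit_right hQ
  have hw : Mᵀ *ᵥ w = (Mᵀ * N * M) *ᵥ (M⁻¹ *ᵥ (N' *ᵥ w)) := by
    rw [mulVec_mulVec, mul_nonsing_inv_cancel_right _ _ hM, mulVec_mulVec, Matrix.mul_assoc, hN,
      Matrix.mul_one]
  have hy : (Mᵀ * N * M)⁻¹ *ᵥ (Mᵀ *ᵥ w) = M⁻¹ *ᵥ (N' *ᵥ w) := by
    rw [hw, mulVec_mulVec, nonsing_inv_mul _ ((Matrix.isUnit_iff_isUnit_det _).1 hQ), one_mulVec]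
  rw [hy, mulVec_transpose, ← dotProduct_mulVec, mulVec_mulVec, mul_nonsing_inv _ hM, one_mulVec]

/-- A Sherman–Morrison formula for `γ² (1 + γ² a aᵀ)` with `γ² = 1 / (1 - ‖a‖²)`. -/
theorem smul_one_add_vecMulVec_mul {n K : Type*} [Fintype n] [DecidableEq n] [Field K]
    {a : n → K} {g : K} (hg : g * (1 - a ⬝ᵥ a) = 1) :
    (g • (1 + g • vecMulVec a a)) * ((1 - a ⬝ᵥ a) • (1 - vecMulVec a a)) = 1 := by
  have h : (1 + g • vecMulVec a a) * (1 - vecMulVec a a) = 1 := by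
    simp only [add_mul, mul_sub, one_mul, mul_one, smul_mul_assoc, vecMulVec_mul_vecMulVec,
      vecMulVec_smul]
    have : g • vecMulVec a a - g • (a ⬝ᵥ a) • vecMulVec a a = vecMulVec a a := by
      rw [smul_smul, ← sub_smul]
      convert one_smul K (vecMulVec a a) using 2
      linear_combination hg
    rw [sub_add_eq_sub_sub_swap, add_sub_assoc, this, add_sub_cancel_right]
  rw [smul_mul_smul_comm, hg, h, one_smul]

theorem norm3_sq (v : Fin 3 → ℝ) : norm3 v ^ 2 = v ⬝ᵥ v := by
  rw [norm3, Real.sq_sqrt (Finset.sum_nonneg fun i _ => sq_nonneg _)]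
  simp only [dotProduct, sq]

/-- for projective effects (unit γ), the steered Bloch vector lies on the
surface of Bob's quantum steering ellipsoid. -/
theorem stmt_9 (ρ : Mat4) (hρ : IsState ρ) (ha : norm3 (aVec ρ) < 1)
    (hQ : IsUnit (QB ρ)) (γ : Fin 3 → ℝ) (hγ : norm3 γ = 1)
    (hpos : 0 < 1 + aVec ρ ⬝ᵥ γ) :
    ((1 + aVec ρ ⬝ᵥ γ)⁻¹ • (bVec ρ + (Tmat ρ)ᵀ *ᵥ γ) - cB ρ) ⬝ᵥ
      ((QB ρ)⁻¹ *ᵥ ((1 + aVec ρ ⬝ᵥ γ)⁻¹ • (bVec ρ + (Tmat ρ)ᵀ *ᵥ γ) - cB ρ)) = 1 := by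
  have hγ' : γ ⬝ᵥ γ = 1 := by rw [← norm3_sq, hγ, one_pow]
  have ha' : 1 - aVec ρ ⬝ᵥ aVec ρ ≠ 0 := by
    have h0 : 0 ≤ norm3 (aVec ρ) := Real.sqrt_nonneg _
    rw [← norm3_sq]
    nlinarith
  unfold cB QB at *
  rw [norm3_sq] at *
  clear hρ ha hγ
  generalize aVec ρ = a at *
  generalize bVec ρ = b at *
  generalize Tmat ρ = T at *
  set g := (1 - a ⬝ᵥ a)⁻¹
  set k := (1 + a ⬝ᵥ γ)⁻¹
  have hga : g * (1 - a ⬝ᵥ a) = 1 := inv_mul_cancel₀ ha'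
  have hks : k * (1 + a ⬝ᵥ γ) = 1 := inv_mul_cancel₀ hpos.ne'
  have hQ' : g • ((Tᵀ - vecMulVec b a) * (1 + g • vecMulVec a a) * (T - vecMulVec a b)) =
      (T - vecMulVec a b)ᵀ * (g • (1 + g • vecMulVec a a)) * (T - vecMulVec a b) := by
    rw [transpose_sub, transpose_vecMulVec, mul_smul_comm, smul_mul_assoc]
  have hw : k • (b + Tᵀ *ᵥ γ) - g • (b - Tᵀ *ᵥ a) =
      (T - vecMulVec a b)ᵀ *ᵥ (k • γ + g • a) := by
    ext i
    simp only [transpose_sub, transpose_vecMulVec, sub_mulVec, vecMulVec_mulVec, mulVec_add,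
      mulVec_smul, Pi.sub_apply, Pi.add_apply, Pi.smul_apply,
      op_smul_eq_smul, smul_eq_mul]
    linear_combination b i * hks - b i * hga
  rw [hQ'] at hQ ⊢
  rw [hw, dotProduct_congruence_inv_mulVec (smul_one_add_vecMulVec_mul hga) hQ]
  simp only [smul_mulVec, sub_mulVec, one_mulVec, vecMulVec_mulVec, dotProduct_smul,
    dotProduct_sub, dotProduct_add, add_dotProduct, smul_dotProduct, smul_eq_mul,
    op_smul_eq_smul, dotProduct_comm γ a, hγ']
  have hinner : k * (k * 1 + g * a ⬝ᵥ γ) + g * (k * a ⬝ᵥ γ + g * a ⬝ᵥ a) -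
      (k * a ⬝ᵥ γ + g * a ⬝ᵥ a) * (k * a ⬝ᵥ γ + g * a ⬝ᵥ a) = g := by
    linear_combination 2 * g * hks - g * hga -
      (k * a ⬝ᵥ γ + g * a ⬝ᵥ a + g - k) * (hks - hga)
  rw [hinner, mul_comm, hga]

end
end

section
/- Let θ ∈ (0, π/4], p ∈ [0,1], and let ρ_M(θ,p) = p φ⁺(θ) + (1−p) ρ_A(θ)⊗(𝟙/2) be the partially entangled state with one-sided coloured noise. Then Alice's quantum steering ellipsoid centre satisfies ‖c_A(ρ_M(θ,p))‖ = (1−p²)cos(2θ)/(1 − p²cos²(2θ)). -/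
open Matrix Kronecker Complex
open scoped ComplexOrder

noncomputable section

/-- The Bloch vector of Alice for the state with one-sided coloured noise. -/
lemma aVec_rhoM (θ p : ℝ) : aVec (rhoM θ p) = ![0, 0, Real.cos (2 * θ)] := by
  ext i
  rw [Real.cos_two_mul']
  fin_cases i <;>
    simp [aVec, rhoM, phiProj, phiVec, rhoA, pauli, Matrix.trace, Matrix.mul_apply,
      Fintype.sum_prod_type, Fin.sum_univ_two, vecMulVec_apply, Matrix.one_apply,
      -Complex.ofReal_cos, -Complex.ofReal_sin, ← Complex.ofReal_pow]
  all_goals ring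

/-- The Bloch vector of Bob for the state with one-sided coloured noise. -/
lemma bVec_rhoM (θ p : ℝ) : bVec (rhoM θ p) = ![0, 0, p * Real.cos (2 * θ)] := by
  ext i
  rw [Real.cos_two_mul']
  fin_cases i <;>
    simp [bVec, rhoM, phiProj, phiVec, rhoA, pauli, Matrix.trace, Matrix.mul_apply,
      Fintype.sum_prod_type, Fin.sum_univ_two, vecMulVec_apply, Matrix.one_apply,
      -Complex.ofReal_cos, -Complex.ofReal_sin, ← Complex.ofReal_pow]
  all_goals ring

/-- The last column of the correlation matrix of the state with one-sided coloured noise. -/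
lemma Tmat_rhoM_apply_two (θ p : ℝ) (i : Fin 3) : Tmat (rhoM θ p) i 2 = ![0, 0, p] i := by
  have h := Real.cos_sq_add_sin_sq θ
  fin_cases i <;>
    simp [Tmat, rhoM, phiProj, phiVec, rhoA, pauli, Matrix.trace, Matrix.mul_apply,
      Fintype.sum_prod_type, Fin.sum_univ_two, vecMulVec_apply, Matrix.one_apply,
      -Complex.ofReal_cos, -Complex.ofReal_sin, ← Complex.ofReal_pow]
  all_goals linear_combination p * h

/-- Alice's QSE centre magnitude of ρ_M(θ,p). -/
theorem stmt_10 (θ p : ℝ) (hθ₀ : 0 < θ) (hθ₁ : θ ≤ Real.pi / 4)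
    (hp₀ : 0 ≤ p) (hp₁ : p ≤ 1) :
    norm3 (cA (rhoM θ p)) =
      (1 - p ^ 2) * Real.cos (2 * θ) / (1 - p ^ 2 * Real.cos (2 * θ) ^ 2) := by
  have hb : norm3 (bVec (rhoM θ p)) ^ 2 = p ^ 2 * Real.cos (2 * θ) ^ 2 := by
    rw [norm3, Real.sq_sqrt (Finset.sum_nonneg fun i _ => sq_nonneg _), bVec_rhoM]
    simp [Fin.sum_univ_three, mul_pow]
  have hc : cA (rhoM θ p) = ![0, 0,
      (1 - p ^ 2) * Real.cos (2 * θ) / (1 - p ^ 2 * Real.cos (2 * θ) ^ 2)] := by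
    ext i
    have hT : (Tmat (rhoM θ p) *ᵥ ![0, 0, p * Real.cos (2 * θ)]) i =
        ![0, 0, p] i * (p * Real.cos (2 * θ)) := by
      simp [Matrix.mulVec, dotProduct, Fin.sum_univ_three, Tmat_rhoM_apply_two]
    rw [cA, hb, aVec_rhoM, bVec_rhoM, Pi.smul_apply, Pi.sub_apply, hT, smul_eq_mul]
    fin_cases i <;> simp
    ring
  have hcos : 0 ≤ Real.cos (2 * θ) :=
    Real.cos_nonneg_of_neg_pi_div_two_le_of_le (by linarith [Real.pi_pos]) (by linarith)
  have hp : p ^ 2 ≤ 1 := pow_le_one₀ hp₀ hp₁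
  have hden : 0 ≤ 1 - p ^ 2 * Real.cos (2 * θ) ^ 2 :=
    sub_nonneg.2 (mul_le_one₀ hp (sq_nonneg _) (Real.cos_sq_le_one _))
  have hnum : 0 ≤ (1 - p ^ 2) * Real.cos (2 * θ) := mul_nonneg (sub_nonneg.2 hp) hcos
  rw [hc, norm3]
  simpa [Fin.sum_univ_three] using Real.sqrt_sq (div_nonneg hnum hden)

end
end

section
/- Let θ ∈ (0, π/4] and p ∈ [0,1], and let ρ' = p Φ⁺ + (1−p)(𝟙₄/4) be the Alice-side filtered version of ρ_M(θ,p) (obtained with the filter f_A = diag(tanθ,1)). Then the CHSH functional of ρ' with the observables A¹ = σ₃, A² = σ₁, B¹ = (σ₃+σ₁)/√2, B² = (σ₃−σ₁)/√2 equals ½(⟨A¹B¹⟩+⟨A¹B²⟩+⟨A²B¹⟩−⟨A²B²⟩) = p√2. In particular, if p > 1/√2 then the filtered state violates the CHSH inequality (value > 1), so the hidden CHSH-inequality violation of ρ_M(θ,p) is locally accessible to Alice. -/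
open Matrix Kronecker Complex
open scoped ComplexOrder

noncomputable section

/-- Correlations of the isotropic state `pΦ⁺ + (1 - p)𝟙₄/4`. -/
lemma expVal_isotropic (p : ℝ) (A B : Mat2) :
    expVal ((p : ℂ) • maxEntProj + ((1 - p : ℝ) : ℂ) • ((1 / 4 : ℂ) • (1 : Mat4))) A B
      = p / 2 * (A * Bᵀ).trace.re + (1 - p) / 4 * (A.trace * B.trace).re := by
  have h_trace : ((A ⊗ₖ B) * maxEntProj).trace = (1 / 2 : ℂ) * (A * Bᵀ).trace := by
    have h_sqrt : ((Real.sqrt 2 : ℂ))⁻¹ * ((Real.sqrt 2 : ℂ))⁻¹ = 1 / 2 := by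
      rw [← mul_inv, ← Complex.ofReal_mul, Real.mul_self_sqrt zero_le_two]
      norm_num
    simp only [Matrix.trace, Matrix.diag_apply, Matrix.mul_apply, Fintype.sum_prod_type,
      Fin.sum_univ_two, kroneckerMap_apply, maxEntProj, vecMulVec_apply, maxEntVec,
      Pi.star_apply, transpose_apply]
    simp [Complex.conj_ofReal]
    linear_combination
      (A 0 0 * B 0 0 + A 0 1 * B 0 1 + A 1 0 * B 1 0 + A 1 1 * B 1 1) * h_sqrt
  have h_eq : ((A ⊗ₖ B) * ((p : ℂ) • maxEntProj +
      ((1 - p : ℝ) : ℂ) • ((1 / 4 : ℂ) • (1 : Mat4)))).trace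
      = ((p / 2 : ℝ) : ℂ) * (A * Bᵀ).trace
        + (((1 - p) / 4 : ℝ) : ℂ) * (A.trace * B.trace) := by
    rw [Matrix.mul_add, Matrix.mul_smul, Matrix.mul_smul, Matrix.mul_smul, Matrix.mul_one,
      Matrix.trace_add, Matrix.trace_smul, Matrix.trace_smul, Matrix.trace_smul, h_trace,
      Matrix.trace_kronecker]
    simp only [smul_eq_mul]
    push_cast
    ring
  rw [expVal, h_eq, Complex.add_re, Complex.re_ofReal_mul, Complex.re_ofReal_mul]

/-- the CHSH functional of the isotropic state pΦ⁺ + (1−p)𝟙₄/4 with the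
observables A¹ = σ₃, A² = σ₁, B¹ = (σ₃+σ₁)/√2, B² = (σ₃−σ₁)/√2 equals p√2; in particular
for p > 1/√2 the filtered state violates the CHSH inequality. -/
theorem stmt_13 (θ p : ℝ) (hθ₀ : 0 < θ) (hθ₁ : θ ≤ Real.pi / 4)
    (hp₀ : 0 ≤ p) (hp₁ : p ≤ 1)
    (ρ' : Mat4)
    (hρ' : ρ' = (p : ℂ) • maxEntProj + ((1 - p : ℝ) : ℂ) • ((1 / 4 : ℂ) • (1 : Mat4)))
    (A1 A2 B1 B2 : Mat2)
    (hA1 : A1 = pauli 2) (hA2 : A2 = pauli 0)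
    (hB1 : B1 = ((Real.sqrt 2 : ℂ))⁻¹ • (pauli 2 + pauli 0))
    (hB2 : B2 = ((Real.sqrt 2 : ℂ))⁻¹ • (pauli 2 - pauli 0)) :
    (expVal ρ' A1 B1 + expVal ρ' A1 B2 + expVal ρ' A2 B1 - expVal ρ' A2 B2) / 2
        = p * Real.sqrt 2 ∧
    ((Real.sqrt 2)⁻¹ < p →
      1 < (expVal ρ' A1 B1 + expVal ρ' A1 B2 + expVal ρ' A2 B1 - expVal ρ' A2 B2) / 2) := by
  have h_sqrt : Real.sqrt 2 * Real.sqrt 2 = 2 := Real.mul_self_sqrt zero_le_two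
  have h_pos : 0 < Real.sqrt 2 := Real.sqrt_pos.mpr zero_lt_two
  have h_chsh : (expVal ρ' A1 B1 + expVal ρ' A1 B2 + expVal ρ' A2 B1 - expVal ρ' A2 B2) / 2
      = p * Real.sqrt 2 := by
    subst hρ' hA1 hA2 hB1 hB2
    have h_inv : Real.sqrt 2 = 2 * (Real.sqrt 2)⁻¹ := by
      field_simp
      linear_combination h_sqrt
    simp only [expVal_isotropic, pauli, ← Complex.ofReal_inv]
    generalize (Real.sqrt 2)⁻¹ = s at h_inv ⊢
    rw [h_inv]
    simp only [Matrix.trace, Matrix.diag_apply, Matrix.mul_apply, transpose_apply,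
      Fin.sum_univ_two]
    simp
    ring
  refine ⟨h_chsh, fun hp => ?_⟩
  rw [h_chsh]
  exact (inv_lt_iff_one_lt_mul₀ h_pos).mp hp

end
end
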